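/- arXiv:2408.04570 — 7 statements merged into one kernel-verified Lean document; each statement's English description precedes it below -/
import Mathlib

section
/- Let K ≥ 1, let π, s, h ∈ ℝ^K with π_a > 0 and s_a > 0 for all a and Σ_a π_a ≤ 1, and let n ≥ 1 be a natural number. Define Σ_n := diag(s_a²/π_a) + (1/n)·diag(h_a²/π_a) − (1/n)·h hᵀ. Then the matrix Σ_n − (min_a s_a²/π_a)·I is positive semidefinite; equivalently, every eigenvalue of Σ_n is at least min_a s_a²/π_a. -/
open Matrix

lemma aux_rank_one_posSemidef (K : ℕ) (π h : Fin K → ℝ)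
    (hπ : ∀ a, 0 < π a) (hsum : ∑ a, π a ≤ 1) :
    (Matrix.diagonal (fun a => h a ^ 2 / π a) - Matrix.vecMulVec h h).PosSemidef := by
  refine Matrix.PosSemidef.of_dotProduct_mulVec_nonneg ?_ ?_
  · ext i j
    by_cases hij : i = j
    · subst hij
      simp
    · simp [Matrix.vecMulVec_apply, Matrix.diagonal_apply, hij, Ne.symm hij, mul_comm]
  · intro x
    have key := Finset.sum_sq_le_sum_mul_sum_of_sq_le_mul Finset.univ
      (r := fun a => x a * h a) (f := π)
      (g := fun a => (x a * h a) ^ 2 / π a)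
      (fun a _ => (hπ a).le) (fun a _ => div_nonneg (sq_nonneg _) (hπ a).le)
      (fun a _ => (show π a * ((x a * h a) ^ 2 / π a) = (x a * h a) ^ 2 by
        have := (hπ a).ne'
        field_simp).ge)
    have hg : 0 ≤ ∑ a, (x a * h a) ^ 2 / π a :=
      Finset.sum_nonneg fun a _ => div_nonneg (sq_nonneg _) (hπ a).le
    have e1 : x ⬝ᵥ (Matrix.diagonal (fun a => h a ^ 2 / π a) *ᵥ x)
        = ∑ a, (x a * h a) ^ 2 / π a := by
      simp only [dotProduct, Matrix.mulVec_diagonal]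
      exact Finset.sum_congr rfl fun a _ => by ring
    have e2 : x ⬝ᵥ (Matrix.vecMulVec h h *ᵥ x) = (∑ a, x a * h a) ^ 2 := by
      simp only [dotProduct, Matrix.mulVec, Matrix.vecMulVec_apply, Finset.mul_sum]
      rw [sq, Finset.sum_mul_sum]
      exact Finset.sum_congr rfl fun a _ => Finset.sum_congr rfl fun b _ => by ring
    rw [star_trivial, Matrix.sub_mulVec, dotProduct_sub, e1, e2]
    nlinarith

/-- Every eigenvalue of `Σ_n = diag(s a ^ 2 / π a) + (1/n) diag(h a ^ 2 / π a) - (1/n) h hᵀ`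
is at least `min_a s a ^ 2 / π a`: the difference
`Σ_n - (min_a s a ^ 2 / π a) • I` is positive semidefinite. -/
theorem sigma_n_sub_minEig_smul_one_posSemidef
    (K : ℕ) (hK : 1 ≤ K) (π s h : Fin K → ℝ)
    (hπ : ∀ a, 0 < π a) (hs : ∀ a, 0 < s a) (hsum : ∑ a, π a ≤ 1)
    (n : ℕ) (hn : 1 ≤ n) :
    ((Matrix.diagonal (fun a => s a ^ 2 / π a) +
        (1 / (n : ℝ)) • Matrix.diagonal (fun a => h a ^ 2 / π a) -
        (1 / (n : ℝ)) • Matrix.vecMulVec h h) -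
      (Finset.univ.inf' ⟨⟨0, hK⟩, Finset.mem_univ _⟩
        (fun a => s a ^ 2 / π a)) • (1 : Matrix (Fin K) (Fin K) ℝ)).PosSemidef := by
  have h1 := (aux_rank_one_posSemidef K π h hπ hsum).smul
    (show (0 : ℝ) ≤ 1 / (n : ℝ) by positivity)
  have h2 : (Matrix.diagonal (fun a => s a ^ 2 / π a -
      Finset.univ.inf' ⟨⟨0, hK⟩, Finset.mem_univ _⟩
        (fun a => s a ^ 2 / π a))).PosSemidef := by
    refine Matrix.PosSemidef.diagonal fun a => ?_
    exact sub_nonneg.2 (Finset.inf'_le (fun a => s a ^ 2 / π a) (Finset.mem_univ a))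
  convert h2.add h1 using 1
  rw [← Matrix.diagonal_sub, Matrix.smul_one_eq_diagonal, smul_sub]
  abel
end

section
/- Let K ≥ 1, let ε > 0, let π, s, h ∈ ℝ^K with ε < π_a ≤ 1 and s_a > 0 for all a and Σ_a π_a ≤ 1, and let n ≥ 1 be a natural number. Define Σ̃_n := diag(π_a s_a²) + (1/n)·diag(π_a h_a²) − (1/n)·(π∘h)(π∘h)ᵀ, where (π∘h)_a = π_a h_a. Then the matrix Σ̃_n − ε·(min_a s_a²)·I is positive semidefinite; equivalently, every eigenvalue of Σ̃_n is at least ε·min_a s_a². -/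
open Matrix

/-- If `ε < π a ≤ 1` for all `a`, every eigenvalue of
`Σ̃_n = diag(π a * s a ^ 2) + (1/n) diag(π a * h a ^ 2) - (1/n) (π∘h)(π∘h)ᵀ`
is at least `ε * min_a s a ^ 2`: the difference
`Σ̃_n - ε * (min_a s a ^ 2) • I` is positive semidefinite. -/
theorem sigmaTilde_n_sub_eps_minEig_smul_one_posSemidef
    (K : ℕ) (hK : 1 ≤ K) (ε : ℝ) (hε : 0 < ε) (π s h : Fin K → ℝ)
    (hπε : ∀ a, ε < π a) (hπ1 : ∀ a, π a ≤ 1) (hs : ∀ a, 0 < s a)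
    (hsum : ∑ a, π a ≤ 1) (n : ℕ) (hn : 1 ≤ n) :
    ((Matrix.diagonal (fun a => π a * s a ^ 2) +
        (1 / (n : ℝ)) • Matrix.diagonal (fun a => π a * h a ^ 2) -
        (1 / (n : ℝ)) • Matrix.vecMulVec (fun a => π a * h a) (fun a => π a * h a)) -
      (ε * Finset.univ.inf' ⟨⟨0, hK⟩, Finset.mem_univ _⟩ (fun a => s a ^ 2)) •
        (1 : Matrix (Fin K) (Fin K) ℝ)).PosSemidef := by
  set m := Finset.univ.inf' ⟨⟨0, hK⟩, Finset.mem_univ _⟩ (fun a => s a ^ 2) with hm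
  have hmle : ∀ a, m ≤ s a ^ 2 := fun a => Finset.inf'_le _ (Finset.mem_univ a)
  have hn0 : 0 ≤ 1 / (n : ℝ) := by positivity
  have hp : ∀ a, 0 < π a := fun a => hε.trans (hπε a)
  refine Matrix.PosSemidef.of_dotProduct_mulVec_nonneg ?_ ?_
  · ext i j
    simp only [Matrix.conjTranspose_apply, Matrix.sub_apply, Matrix.add_apply, Matrix.smul_apply,
      Matrix.vecMulVec_apply, Matrix.diagonal_apply, Matrix.one_apply, star_trivial, smul_eq_mul]
    by_cases hij : i = j
    · subst hij
      simp
    · simp [hij, Ne.symm hij, mul_comm]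
  · intro x
    have key : star x ⬝ᵥ (((Matrix.diagonal (fun a => π a * s a ^ 2) +
        (1 / (n : ℝ)) • Matrix.diagonal (fun a => π a * h a ^ 2) -
        (1 / (n : ℝ)) • Matrix.vecMulVec (fun a => π a * h a) (fun a => π a * h a)) -
        (ε * m) • (1 : Matrix (Fin K) (Fin K) ℝ)) *ᵥ x) =
        ∑ a, (π a * s a ^ 2 - ε * m) * x a ^ 2 +
        (1 / (n : ℝ)) * (∑ a, π a * (h a * x a) ^ 2 - (∑ a, π a * (h a * x a)) ^ 2) := by
      have hv : (∑ a, π a * (h a * x a)) ^ 2 =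
          ∑ a, x a * (π a * h a * ∑ b, π b * h b * x b) := by
        rw [sq, Finset.sum_mul]
        refine Finset.sum_congr rfl fun a _ => ?_
        simp only [mul_assoc]
        ring
      rw [hv, ← Finset.sum_sub_distrib, Finset.mul_sum, ← Finset.sum_add_distrib]
      simp only [Matrix.sub_mulVec, Matrix.add_mulVec, Matrix.smul_mulVec, Matrix.one_mulVec,
        Matrix.vecMulVec_mulVec, dotProduct, Pi.sub_apply, Pi.add_apply, Pi.smul_apply,
        Matrix.mulVec_diagonal, star_trivial, smul_eq_mul, MulOpposite.smul_eq_mul_unop,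
        MulOpposite.unop_op]
      refine Finset.sum_congr rfl fun a _ => ?_
      ring
    rw [key]
    have h1 : 0 ≤ ∑ a, (π a * s a ^ 2 - ε * m) * x a ^ 2 := by
      refine Finset.sum_nonneg fun a _ => mul_nonneg ?_ (sq_nonneg _)
      have e1 := mul_le_mul_of_nonneg_left (hmle a) hε.le
      have e2 := mul_le_mul_of_nonneg_right (hπε a).le (sq_nonneg (s a))
      linarith
    have h2 : (∑ a, π a * (h a * x a)) ^ 2 ≤ (∑ a, π a) * ∑ a, π a * (h a * x a) ^ 2 := by
      refine Finset.sum_sq_le_sum_mul_sum_of_sq_eq_mul _ (fun a _ => (hp a).le)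
        (fun a _ => mul_nonneg (hp a).le (sq_nonneg _)) (fun a _ => by ring)
    have h3 : 0 ≤ ∑ a, π a * (h a * x a) ^ 2 :=
      Finset.sum_nonneg fun a _ => mul_nonneg (hp a).le (sq_nonneg _)
    have h4 := mul_le_mul_of_nonneg_right hsum h3
    exact add_nonneg h1 (mul_nonneg hn0 (by linarith))
end

section
/- Let K ≥ 1, let π, s, h ∈ ℝ^K with π_a > 0 and s_a > 0 for all a and Σ_a π_a ≤ 1, and let n ≥ 1 be a natural number. Define Σ_n := diag(s_a²/π_a) + (1/n)·diag(h_a²/π_a) − (1/n)·h hᵀ. Then log det Σ_n ≥ Σ_a log( s_a²/π_a + h_a²/(n π_a) ) − (1/n) · (max_a h_a²/s_a²) / (1 − max_a h_a²/(s_a² + h_a²)). -/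
open Matrix

/-- Lower bound on `log det Σ_n` where
`Σ_n = diag(s a ^ 2 / π a) + (1/n) diag(h a ^ 2 / π a) - (1/n) h hᵀ`:
`log det Σ_n ≥ ∑ a, log (s a ^ 2 / π a + h a ^ 2 / (n * π a))
  - (1/n) * (max_a h a ^ 2 / s a ^ 2) / (1 - max_a h a ^ 2 / (s a ^ 2 + h a ^ 2))`. -/
theorem log_det_sigma_n_ge
    (K : ℕ) (hK : 1 ≤ K) (π s h : Fin K → ℝ)
    (hπ : ∀ a, 0 < π a) (hs : ∀ a, 0 < s a) (hsum : ∑ a, π a ≤ 1)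
    (n : ℕ) (hn : 1 ≤ n) :
    Real.log (Matrix.diagonal (fun a => s a ^ 2 / π a) +
        (1 / (n : ℝ)) • Matrix.diagonal (fun a => h a ^ 2 / π a) -
        (1 / (n : ℝ)) • Matrix.vecMulVec h h).det ≥
      (∑ a, Real.log (s a ^ 2 / π a + h a ^ 2 / (n * π a))) -
        (1 / (n : ℝ)) *
          (Finset.univ.sup' ⟨⟨0, hK⟩, Finset.mem_univ _⟩ (fun a => h a ^ 2 / s a ^ 2)) /
          (1 - Finset.univ.sup' ⟨⟨0, hK⟩, Finset.mem_univ _⟩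
            (fun a => h a ^ 2 / (s a ^ 2 + h a ^ 2))) := by
  classical
  have hn0 : (0:ℝ) < n := by exact_mod_cast hn
  have hn1 : (1:ℝ) ≤ n := by exact_mod_cast hn
  set M₁ := Finset.univ.sup' ⟨⟨0, hK⟩, Finset.mem_univ _⟩ (fun a => h a ^ 2 / s a ^ 2) with hM₁
  set M₂ := Finset.univ.sup' ⟨⟨0, hK⟩, Finset.mem_univ _⟩
            (fun a => h a ^ 2 / (s a ^ 2 + h a ^ 2)) with hM₂
  have h1 : ∀ a, h a ^ 2 / s a ^ 2 ≤ M₁ := fun a =>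
    Finset.le_sup' (fun a => h a ^ 2 / s a ^ 2) (Finset.mem_univ a)
  have h2 : ∀ a, h a ^ 2 / (s a ^ 2 + h a ^ 2) ≤ M₂ := fun a =>
    Finset.le_sup' (fun a => h a ^ 2 / (s a ^ 2 + h a ^ 2)) (Finset.mem_univ a)
  have hM₂1 : M₂ < 1 := by
    refine (Finset.sup'_lt_iff _).2 ?_
    intro a _
    have := hs a
    rw [div_lt_one (by positivity)]
    have : 0 < s a ^ 2 := by positivity
    linarith
  have hM₁0 : 0 ≤ M₁ := le_trans (by positivity) (h1 ⟨0, hK⟩)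
  have hM₂0 : 0 ≤ M₂ := le_trans (by positivity) (h2 ⟨0, hK⟩)
  set d : Fin K → ℝ := fun a => s a ^ 2 / π a + h a ^ 2 / (n * π a) with hd
  have hdpos : ∀ a, 0 < d a := by
    intro a
    have := hs a
    have := hπ a
    simp only [hd]
    positivity
  set t : ℝ := ∑ a, h a * (h a / (n * d a)) with ht
  have hterm : ∀ a, h a * (h a / (n * d a)) = π a * (h a ^ 2 / (n * s a ^ 2 + h a ^ 2)) := by
    intro a
    have h3 := hs a
    have h4 := hπ a
    have h5 : (n * d a) = (n * s a ^ 2 + h a ^ 2) / π a := by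
      simp only [hd]
      field_simp
    have h6 : 0 < n * s a ^ 2 + h a ^ 2 := by positivity
    rw [h5]
    field_simp
  have key : ∀ C : ℝ, 0 ≤ C → (∀ a, h a ^ 2 / (n * s a ^ 2 + h a ^ 2) ≤ C) → t ≤ C := by
    intro C hC hb
    calc t ≤ ∑ a, π a * C := by
          rw [ht]
          refine Finset.sum_le_sum fun a _ => ?_
          rw [hterm]
          exact mul_le_mul_of_nonneg_left (hb a) (hπ a).le
      _ = (∑ a, π a) * C := by rw [Finset.sum_mul]
      _ ≤ 1 * C := mul_le_mul_of_nonneg_right hsum hC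
      _ = C := one_mul C
  have ht2 : t ≤ M₂ := by
    refine key _ hM₂0 fun a => le_trans ?_ (h2 a)
    have h3 := hs a
    have h4 : 0 < s a ^ 2 := by positivity
    refine div_le_div_of_nonneg_left (by positivity) (by positivity) ?_
    nlinarith
  have ht1 : t ≤ 1 / n * M₁ := by
    refine key _ (by positivity) fun a => ?_
    have h3 := hs a
    calc h a ^ 2 / (n * s a ^ 2 + h a ^ 2) ≤ h a ^ 2 / (n * s a ^ 2) := by
          refine div_le_div_of_nonneg_left (by positivity) (by positivity) ?_
          nlinarith [sq_nonneg (h a)]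
      _ = 1 / n * (h a ^ 2 / s a ^ 2) := by field_simp
      _ ≤ _ := mul_le_mul_of_nonneg_left (h1 a) (by positivity)
  have hmat : Matrix.diagonal (fun a => s a ^ 2 / π a) +
        (1 / (n : ℝ)) • Matrix.diagonal (fun a => h a ^ 2 / π a) -
        (1 / (n : ℝ)) • Matrix.vecMulVec h h
      = Matrix.diagonal d * (1 + Matrix.replicateCol Unit (fun a => -(h a / (n * d a))) *
          Matrix.replicateRow Unit h) := by
    ext i j
    have h3 := (hdpos i).ne'
    have h4 := (hπ i).ne'
    have e : d i = s i ^ 2 / π i + h i ^ 2 / (n * π i) := rfl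
    rw [Matrix.diagonal_mul]
    simp only [Matrix.sub_apply, Matrix.add_apply, Matrix.smul_apply, Matrix.vecMulVec_apply,
      Matrix.mul_apply, Matrix.replicateCol_apply, Matrix.replicateRow_apply, smul_eq_mul,
      Finset.univ_unique, Finset.sum_singleton, mul_add]
    have e2 : d i * (-(h i / (n * d i)) * h j) = - (1 / n * (h i * h j)) := by
      field_simp
    rw [e2]
    by_cases hij : i = j
    · subst hij
      simp only [Matrix.diagonal_apply_eq, Matrix.one_apply_eq]
      rw [e]
      field_simp
      ring
    · simp [Matrix.diagonal_apply_ne _ hij, Matrix.one_apply_ne hij]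
  have hdet : (Matrix.diagonal (fun a => s a ^ 2 / π a) +
        (1 / (n : ℝ)) • Matrix.diagonal (fun a => h a ^ 2 / π a) -
        (1 / (n : ℝ)) • Matrix.vecMulVec h h).det = (∏ a, d a) * (1 - t) := by
    rw [hmat, Matrix.det_mul, Matrix.det_diagonal,
      Matrix.det_one_add_replicateCol_mul_replicateRow]
    simp [dotProduct, ht, sub_eq_add_neg]
  have htp : 0 < 1 - t := by linarith
  rw [hdet, Real.log_mul (Finset.prod_ne_zero_iff.mpr fun a _ => (hdpos a).ne') htp.ne',
    Real.log_prod (fun a _ => (hdpos a).ne')]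
  have hlog := Real.one_sub_inv_le_log_of_pos htp
  have e3 : 1 - (1 - t)⁻¹ = - (t / (1 - t)) := by
    field_simp
    ring
  have e4 : t / (1 - t) ≤ 1 / n * M₁ / (1 - M₂) :=
    div_le_div₀ (by positivity) ht1 (by linarith) (by linarith)
  rw [e3] at hlog
  linarith
end

section
/- Let K ≥ 1, let π, s, h ∈ ℝ^K with 0 < π_a ≤ 1 and s_a > 0 for all a and Σ_a π_a ≤ 1, and let n ≥ 1 be a natural number. Define Σ := diag(s_a²/π_a) and Σ_n := diag(s_a²/π_a) + (1/n)·diag(h_a²/π_a) − (1/n)·h hᵀ. Then trace(Σ⁻¹ Σ_n) − K + log det Σ − log det Σ_n ≤ (1/n) · [ (max_a h_a²/s_a²) / (1 − max_a h_a²/(s_a² + h_a²)) + Σ_a h_a²/s_a² ]. (This quantity is the standard expression for the Kullback–Leibler divergence between the Gaussian distributions N(h, Σ_n) and N(h, Σ), so this is the bound of Lemma kl-cov.) -/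
open Matrix

lemma kl_det_aux {K : ℕ} (p s h : Fin K → ℝ) (hp : ∀ a, 0 < p a) (hs : ∀ a, 0 < s a)
    (c : ℝ) (hc : 0 < c) :
    (Matrix.diagonal (fun a => s a ^ 2 / p a) +
          c • Matrix.diagonal (fun a => h a ^ 2 / p a) -
          c • Matrix.vecMulVec h h).det =
      (∏ a, (s a ^ 2 + c * h a ^ 2) / p a) *
        (1 - ∑ a, p a * (c * h a ^ 2) / (s a ^ 2 + c * h a ^ 2)) := by
  have hd : ∀ a, 0 < s a ^ 2 + c * h a ^ 2 := fun a => by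
    have := hs a
    positivity
  have e : (Matrix.diagonal (fun a => s a ^ 2 / p a) +
          c • Matrix.diagonal (fun a => h a ^ 2 / p a) -
          c • Matrix.vecMulVec h h) =
      Matrix.diagonal (fun a => (s a ^ 2 + c * h a ^ 2) / p a) *
        (1 + replicateCol Unit (fun a => - (c * h a * p a / (s a ^ 2 + c * h a ^ 2))) *
          replicateRow Unit h) := by
    rw [← Matrix.vecMulVec_eq]
    ext i j
    have h1 := (hd i).ne'
    have h2 := (hp i).ne'
    rw [Matrix.diagonal_mul]
    by_cases hij : i = j
    · subst hij
      simp [Matrix.vecMulVec_apply]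
      field_simp
      ring
    · simp [Matrix.vecMulVec_apply, hij]
      field_simp
  rw [e, Matrix.det_mul, Matrix.det_diagonal, Matrix.det_one_add_replicateCol_mul_replicateRow]
  congr 1
  rw [sub_eq_add_neg, dotProduct, ← Finset.sum_neg_distrib]
  congr 1
  apply Finset.sum_congr rfl
  intro a _
  ring

/-- The KL divergence between `N(h, Σ_n)` and `N(h, Σ)`, written in its standard closed
form `trace (Σ⁻¹ Σ_n) - K + log det Σ - log det Σ_n`, is bounded by
`(1/n) * ((max_a h a ^ 2 / s a ^ 2) / (1 - max_a h a ^ 2 / (s a ^ 2 + h a ^ 2))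
  + ∑ a, h a ^ 2 / s a ^ 2)`, where `Σ = diag(s a ^ 2 / π a)` and
`Σ_n = diag(s a ^ 2 / π a) + (1/n) diag(h a ^ 2 / π a) - (1/n) h hᵀ`. -/
theorem kl_cov_bound
    (K : ℕ) (hK : 1 ≤ K) (π s h : Fin K → ℝ)
    (hπ0 : ∀ a, 0 < π a) (hπ1 : ∀ a, π a ≤ 1) (hs : ∀ a, 0 < s a)
    (hsum : ∑ a, π a ≤ 1) (n : ℕ) (hn : 1 ≤ n) :
    ((Matrix.diagonal (fun a => s a ^ 2 / π a))⁻¹ *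
          (Matrix.diagonal (fun a => s a ^ 2 / π a) +
            (1 / (n : ℝ)) • Matrix.diagonal (fun a => h a ^ 2 / π a) -
            (1 / (n : ℝ)) • Matrix.vecMulVec h h)).trace - K +
        Real.log (Matrix.diagonal (fun a => s a ^ 2 / π a)).det -
        Real.log (Matrix.diagonal (fun a => s a ^ 2 / π a) +
          (1 / (n : ℝ)) • Matrix.diagonal (fun a => h a ^ 2 / π a) -
          (1 / (n : ℝ)) • Matrix.vecMulVec h h).det ≤
      (1 / (n : ℝ)) *
        ((Finset.univ.sup' ⟨⟨0, hK⟩, Finset.mem_univ _⟩ (fun a => h a ^ 2 / s a ^ 2)) /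
            (1 - Finset.univ.sup' ⟨⟨0, hK⟩, Finset.mem_univ _⟩
              (fun a => h a ^ 2 / (s a ^ 2 + h a ^ 2))) +
          ∑ a, h a ^ 2 / s a ^ 2) := by
  have hn0 : (0 : ℝ) < n := by exact_mod_cast hn
  have hc : (0 : ℝ) < 1 / (n : ℝ) := by positivity
  rw [kl_det_aux π s h hπ0 hs _ hc]
  set c : ℝ := 1 / (n : ℝ) with hcdef
  have hd : ∀ a, 0 < s a ^ 2 + c * h a ^ 2 := fun a => by
    have := hs a
    positivity
  set M := Finset.univ.sup' ⟨⟨0, hK⟩, Finset.mem_univ _⟩ (fun a => h a ^ 2 / s a ^ 2) with hM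
  set m := Finset.univ.sup' ⟨⟨0, hK⟩, Finset.mem_univ _⟩
    (fun a => h a ^ 2 / (s a ^ 2 + h a ^ 2)) with hm
  have hMa : ∀ a, h a ^ 2 / s a ^ 2 ≤ M := fun a =>
    Finset.le_sup' (fun a => h a ^ 2 / s a ^ 2) (Finset.mem_univ a)
  have hma : ∀ a, h a ^ 2 / (s a ^ 2 + h a ^ 2) ≤ m := fun a =>
    Finset.le_sup' (fun a => h a ^ 2 / (s a ^ 2 + h a ^ 2)) (Finset.mem_univ a)
  have hM0 : 0 ≤ M := le_trans (by positivity) (hMa ⟨0, hK⟩)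
  have hm0 : 0 ≤ m := le_trans (by positivity) (hma ⟨0, hK⟩)
  have hm1 : m < 1 := by
    refine (Finset.sup'_lt_iff _).2 ?_
    intro a _
    have := hs a
    rw [div_lt_one (by positivity)]
    have : 0 < s a ^ 2 := by positivity
    linarith
  have hMm : M ≤ M / (1 - m) := by
    rw [le_div_iff₀ (by linarith)]
    nlinarith
  -- trace
  have htr : ((Matrix.diagonal (fun a => s a ^ 2 / π a))⁻¹ *
          (Matrix.diagonal (fun a => s a ^ 2 / π a) +
            c • Matrix.diagonal (fun a => h a ^ 2 / π a) -
            c • Matrix.vecMulVec h h)).trace ≤ K + c * ∑ a, h a ^ 2 / s a ^ 2 := by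
    have hinv : (Matrix.diagonal (fun a => s a ^ 2 / π a))⁻¹ =
        Matrix.diagonal (fun a => π a / s a ^ 2) := by
      apply Matrix.inv_eq_left_inv
      rw [Matrix.diagonal_mul_diagonal, ← Matrix.diagonal_one]
      congr 1
      funext a
      have := (hs a).ne'
      have := (hπ0 a).ne'
      field_simp
    rw [hinv, Matrix.trace]
    have hK' : (K : ℝ) = ∑ _a : Fin K, (1 : ℝ) := by simp
    rw [hK', Finset.mul_sum, ← Finset.sum_add_distrib]
    apply Finset.sum_le_sum
    intro a _
    have h1 := hs a
    have h2 := hπ0 a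
    rw [Matrix.diag_apply, Matrix.diagonal_mul]
    simp only [Matrix.sub_apply, Matrix.add_apply, Matrix.smul_apply, Matrix.diagonal_apply_eq,
      Matrix.vecMulVec_apply, smul_eq_mul]
    have e : π a / s a ^ 2 * (s a ^ 2 / π a + c * (h a ^ 2 / π a) - c * (h a * h a)) =
        1 + c * (h a ^ 2 / s a ^ 2) - π a / s a ^ 2 * (c * h a ^ 2) := by
      field_simp
    rw [e]
    have : 0 ≤ π a / s a ^ 2 * (c * h a ^ 2) := by positivity
    linarith
  -- the scalar factor
  set t := ∑ a, π a * (c * h a ^ 2) / (s a ^ 2 + c * h a ^ 2) with ht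
  have hcM : 0 < 1 + c * M := by positivity
  have htle : t ≤ c * M / (1 + c * M) := by
    calc t ≤ ∑ a, π a * (c * M / (1 + c * M)) := by
          apply Finset.sum_le_sum
          intro a _
          have h1 := hs a
          rw [mul_div_assoc]
          apply mul_le_mul_of_nonneg_left _ (hπ0 a).le
          rw [div_le_div_iff₀ (hd a) hcM]
          have h3 := hMa a
          rw [div_le_iff₀ (by positivity)] at h3
          nlinarith [mul_le_mul_of_nonneg_left h3 hc.le]
      _ = (∑ a, π a) * (c * M / (1 + c * M)) := by rw [Finset.sum_mul]
      _ ≤ 1 * (c * M / (1 + c * M)) := by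
          apply mul_le_mul_of_nonneg_right hsum
          positivity
      _ = _ := one_mul _
  have h1t : 1 / (1 + c * M) ≤ 1 - t := by
    have : 1 / (1 + c * M) = 1 - c * M / (1 + c * M) := by
      field_simp
      ring
    linarith
  have h1t0 : 0 < 1 - t := lt_of_lt_of_le (by positivity) h1t
  have hlogt : - Real.log (1 - t) ≤ c * M := by
    have h1 := Real.log_le_log (by positivity) h1t
    rw [one_div, Real.log_inv] at h1
    have h2 := Real.log_le_sub_one_of_pos hcM
    linarith
  have hP0 : 0 < ∏ a, s a ^ 2 / π a := Finset.prod_pos fun a _ => by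
    have := hs a
    have := hπ0 a
    positivity
  have hPle : ∏ a, s a ^ 2 / π a ≤ ∏ a, (s a ^ 2 + c * h a ^ 2) / π a := by
    apply Finset.prod_le_prod
    · intro a _
      have := hπ0 a
      positivity
    · intro a _
      apply div_le_div_of_nonneg_right _ (hπ0 a).le
      have : 0 ≤ c * h a ^ 2 := by positivity
      linarith
  have hlogP := Real.log_le_log hP0 hPle
  rw [Matrix.det_diagonal, Real.log_mul (lt_of_lt_of_le hP0 hPle).ne' h1t0.ne', mul_add]
  have := mul_le_mul_of_nonneg_left hMm hc.le
  linarith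
end

section
/- Let K ≥ 1, let π, s, h ∈ ℝ^K with 0 < π_a ≤ 1 and s_a > 0 for all a and Σ_a π_a ≤ 1, and let n ≥ 1 be a natural number. Define Σ̃_n := diag(π_a s_a²) + (1/n)·diag(π_a h_a²) − (1/n)·(π∘h)(π∘h)ᵀ, where (π∘h)_a = π_a h_a. Then log det Σ̃_n ≥ Σ_a log( π_a s_a² + π_a h_a²/n ) − (1/n) · (max_a h_a²/s_a²) / (1 − max_a h_a²/(s_a² + h_a²)). -/
open Matrix

/-- Lower bound on `log det Σ̃_n` where
`Σ̃_n = diag(π a * s a ^ 2) + (1/n) diag(π a * h a ^ 2) - (1/n) (π∘h)(π∘h)ᵀ`: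
`log det Σ̃_n ≥ ∑ a, log (π a * s a ^ 2 + π a * h a ^ 2 / n)
  - (1/n) * (max_a h a ^ 2 / s a ^ 2) / (1 - max_a h a ^ 2 / (s a ^ 2 + h a ^ 2))`. -/
theorem log_det_sigmaTilde_n_ge
    (K : ℕ) (hK : 1 ≤ K) (π s h : Fin K → ℝ)
    (hπ0 : ∀ a, 0 < π a) (hπ1 : ∀ a, π a ≤ 1) (hs : ∀ a, 0 < s a)
    (hsum : ∑ a, π a ≤ 1) (n : ℕ) (hn : 1 ≤ n) :
    Real.log (Matrix.diagonal (fun a => π a * s a ^ 2) +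
        (1 / (n : ℝ)) • Matrix.diagonal (fun a => π a * h a ^ 2) -
        (1 / (n : ℝ)) • Matrix.vecMulVec (fun a => π a * h a) (fun a => π a * h a)).det ≥
      (∑ a, Real.log (π a * s a ^ 2 + π a * h a ^ 2 / n)) -
        (1 / (n : ℝ)) *
          (Finset.univ.sup' ⟨⟨0, hK⟩, Finset.mem_univ _⟩ (fun a => h a ^ 2 / s a ^ 2)) /
          (1 - Finset.univ.sup' ⟨⟨0, hK⟩, Finset.mem_univ _⟩
            (fun a => h a ^ 2 / (s a ^ 2 + h a ^ 2))) := by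
  have hn0 : (0 : ℝ) < n := by exact_mod_cast hn
  have hn1 : (1 : ℝ) ≤ n := by exact_mod_cast hn
  set M := Finset.univ.sup' ⟨⟨0, hK⟩, Finset.mem_univ _⟩ (fun a => h a ^ 2 / s a ^ 2) with hM
  set m := Finset.univ.sup' ⟨⟨0, hK⟩, Finset.mem_univ _⟩
            (fun a => h a ^ 2 / (s a ^ 2 + h a ^ 2)) with hm
  have hMa : ∀ a, h a ^ 2 / s a ^ 2 ≤ M := fun a =>
    Finset.le_sup' (fun a => h a ^ 2 / s a ^ 2) (Finset.mem_univ a)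
  have hma : ∀ a, h a ^ 2 / (s a ^ 2 + h a ^ 2) ≤ m := fun a =>
    Finset.le_sup' (fun a => h a ^ 2 / (s a ^ 2 + h a ^ 2)) (Finset.mem_univ a)
  have hM0 : 0 ≤ M := le_trans (by positivity) (hMa ⟨0, hK⟩)
  have hm0 : 0 ≤ m := le_trans (by positivity) (hma ⟨0, hK⟩)
  have hm1 : m < 1 := by
    refine (Finset.sup'_lt_iff _).2 ?_
    intro a _
    have := pow_pos (hs a) 2
    rw [div_lt_one (by positivity)]
    linarith
  set d : Fin K → ℝ := fun a => π a * s a ^ 2 + π a * h a ^ 2 / n with hd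
  have hd0 : ∀ a, 0 < d a := fun a => by
    have := hs a
    have := hπ0 a
    simp only [hd]
    positivity
  set r : Fin K → ℝ := fun a => h a ^ 2 / (n * s a ^ 2 + h a ^ 2) with hr
  set t := ∑ a, π a * r a with ht
  have hr0 : ∀ a, 0 ≤ r a := fun a => by simp only [hr]; positivity
  have ht0 : 0 ≤ t := Finset.sum_nonneg fun a _ => mul_nonneg (hπ0 a).le (hr0 a)
  have key : ∀ c, 0 ≤ c → (∀ a, r a ≤ c) → t ≤ c := by
    intro c hc h1
    calc t ≤ ∑ a, π a * c :=
          Finset.sum_le_sum fun a _ => mul_le_mul_of_nonneg_left (h1 a) (hπ0 a).le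
      _ = (∑ a, π a) * c := by rw [Finset.sum_mul]
      _ ≤ 1 * c := mul_le_mul_of_nonneg_right hsum hc
      _ = c := one_mul c
  have htm : t ≤ m := key m hm0 fun a => by
    refine le_trans ?_ (hma a)
    have := pow_pos (hs a) 2
    simp only [hr]
    gcongr
    nlinarith
  have htM : t ≤ 1 / (n : ℝ) * M := key _ (by positivity) fun a => by
    have := pow_pos (hs a) 2
    calc r a ≤ h a ^ 2 / (n * s a ^ 2) := by
          simp only [hr]
          gcongr
          nlinarith [sq_nonneg (h a)]
      _ = 1 / (n : ℝ) * (h a ^ 2 / s a ^ 2) := by field_simp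
      _ ≤ _ := mul_le_mul_of_nonneg_left (hMa a) (by positivity)
  have hdet : (Matrix.diagonal (fun a => π a * s a ^ 2) +
        (1 / (n : ℝ)) • Matrix.diagonal (fun a => π a * h a ^ 2) -
        (1 / (n : ℝ)) • Matrix.vecMulVec (fun a => π a * h a) (fun a => π a * h a)).det
      = (∏ a, d a) * (1 - t) := by
    have hfac : (Matrix.diagonal (fun a => π a * s a ^ 2) +
        (1 / (n : ℝ)) • Matrix.diagonal (fun a => π a * h a ^ 2) -
        (1 / (n : ℝ)) • Matrix.vecMulVec (fun a => π a * h a) (fun a => π a * h a))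
        = Matrix.diagonal d * (1 + Matrix.replicateCol Unit (fun a => -(1 / (n : ℝ)) * (π a * h a) / d a)
            * Matrix.replicateRow Unit (fun a => π a * h a)) := by
      ext i j
      have hdi := (hd0 i).ne'
      rw [Matrix.diagonal_mul]
      have e : (Matrix.replicateCol Unit (fun a => -(1 / (n : ℝ)) * (π a * h a) / d a)
            * Matrix.replicateRow Unit (fun a => π a * h a)) i j
            = (-(1 / (n : ℝ)) * (π i * h i) / d i) * (π j * h j) := by
        simp [Matrix.mul_apply]
      rw [Matrix.add_apply, e, mul_add, ← mul_assoc, mul_div_cancel₀ _ hdi]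
      by_cases hij : i = j
      · subst hij
        simp [Matrix.vecMulVec_apply, hd]
        ring
      · simp [Matrix.vecMulVec_apply, hij]
        ring
    rw [hfac, Matrix.det_mul, Matrix.det_diagonal, Matrix.det_one_add_replicateCol_mul_replicateRow]
    congr 1
    rw [sub_eq_add_neg, ht, ← Finset.sum_neg_distrib]
    congr 1
    refine Finset.sum_congr rfl fun a _ => ?_
    have h1 := hs a
    have h2 := hπ0 a
    have h3 : d a = π a * (n * s a ^ 2 + h a ^ 2) / n := by
      simp only [hd]; field_simp
    have h4 : 0 < n * s a ^ 2 + h a ^ 2 := by positivity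
    beta_reduce
    rw [h3]
    simp only [hr]
    field_simp
  have h1t : 0 < 1 - t := by linarith
  rw [hdet, Real.log_mul (Finset.prod_pos fun a _ => hd0 a).ne' h1t.ne',
    Real.log_prod (fun a _ => (hd0 a).ne')]
  have hlog := Real.one_sub_inv_le_log_of_pos h1t
  have hfrac : t / (1 - t) ≤ 1 / (n : ℝ) * M / (1 - m) :=
    div_le_div₀ (by positivity) htM (by linarith) (by linarith)
  have he : 1 - (1 - t)⁻¹ = - (t / (1 - t)) := by
    field_simp
    ring
  change _ ≥ ∑ a, Real.log (d a) - _
  linarith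
end

section
/- Let K ≥ 1, let π, s, h ∈ ℝ^K with 0 < π_a ≤ 1 and s_a > 0 for all a and Σ_a π_a ≤ 1, and let n ≥ 1 be a natural number. Define Σ̃ := diag(π_a s_a²) and Σ̃_n := diag(π_a s_a²) + (1/n)·diag(π_a h_a²) − (1/n)·(π∘h)(π∘h)ᵀ, where (π∘h)_a = π_a h_a. Then trace(Σ̃⁻¹ Σ̃_n) − K + log det Σ̃ − log det Σ̃_n ≤ (1/n) · [ (max_a h_a²/s_a²) / (1 − max_a h_a²/(s_a² + h_a²)) + Σ_a h_a²/s_a² ]. (This quantity is the standard expression for the Kullback–Leibler divergence between the Gaussian distributions N(0, Σ̃_n) and N(0, Σ̃), so this is the bound of Lemma bayes-kl-cov.) -/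
open Matrix

lemma aux_det (K : ℕ) (d v : Fin K → ℝ) (c : ℝ) (hd : ∀ a, d a ≠ 0) :
    (Matrix.diagonal d - c • Matrix.vecMulVec v v).det
      = (∏ a, d a) * (1 - ∑ a, c * v a ^ 2 / d a) := by
  have h1 : Matrix.diagonal d - c • Matrix.vecMulVec v v
      = Matrix.diagonal d * (1 + Matrix.replicateCol Unit (fun a => -(c * v a / d a))
          * Matrix.replicateRow Unit v) := by
    rw [← Matrix.vecMulVec_eq Unit]
    ext i j
    rw [Matrix.diagonal_mul]
    simp only [Matrix.sub_apply, Matrix.add_apply, Matrix.smul_apply, Matrix.vecMulVec_apply,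
      Matrix.diagonal_apply, Matrix.one_apply, smul_eq_mul]
    have := hd i
    split_ifs <;> field_simp <;> ring
  rw [h1, Matrix.det_mul, Matrix.det_diagonal, Matrix.det_one_add_replicateCol_mul_replicateRow]
  congr 1
  rw [sub_eq_add_neg, ← Finset.sum_neg_distrib]
  congr 1
  apply Finset.sum_congr rfl
  intro a _
  ring

/-- The KL divergence between `N(0, Σ̃_n)` and `N(0, Σ̃)`, written in its standard closed
form `trace (Σ̃⁻¹ Σ̃_n) - K + log det Σ̃ - log det Σ̃_n`, is bounded by
`(1/n) * ((max_a h a ^ 2 / s a ^ 2) / (1 - max_a h a ^ 2 / (s a ^ 2 + h a ^ 2))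
  + ∑ a, h a ^ 2 / s a ^ 2)`, where `Σ̃ = diag(π a * s a ^ 2)` and
`Σ̃_n = diag(π a * s a ^ 2) + (1/n) diag(π a * h a ^ 2) - (1/n) (π∘h)(π∘h)ᵀ`. -/
theorem bayes_kl_cov_bound
    (K : ℕ) (hK : 1 ≤ K) (π s h : Fin K → ℝ)
    (hπ0 : ∀ a, 0 < π a) (hπ1 : ∀ a, π a ≤ 1) (hs : ∀ a, 0 < s a)
    (hsum : ∑ a, π a ≤ 1) (n : ℕ) (hn : 1 ≤ n) :
    ((Matrix.diagonal (fun a => π a * s a ^ 2))⁻¹ *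
          (Matrix.diagonal (fun a => π a * s a ^ 2) +
            (1 / (n : ℝ)) • Matrix.diagonal (fun a => π a * h a ^ 2) -
            (1 / (n : ℝ)) • Matrix.vecMulVec (fun a => π a * h a)
              (fun a => π a * h a))).trace - K +
        Real.log (Matrix.diagonal (fun a => π a * s a ^ 2)).det -
        Real.log (Matrix.diagonal (fun a => π a * s a ^ 2) +
          (1 / (n : ℝ)) • Matrix.diagonal (fun a => π a * h a ^ 2) -
          (1 / (n : ℝ)) • Matrix.vecMulVec (fun a => π a * h a)
            (fun a => π a * h a)).det ≤
      (1 / (n : ℝ)) *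
        ((Finset.univ.sup' ⟨⟨0, hK⟩, Finset.mem_univ _⟩ (fun a => h a ^ 2 / s a ^ 2)) /
            (1 - Finset.univ.sup' ⟨⟨0, hK⟩, Finset.mem_univ _⟩
              (fun a => h a ^ 2 / (s a ^ 2 + h a ^ 2))) +
          ∑ a, h a ^ 2 / s a ^ 2) := by
  have hn0 : (1 : ℝ) ≤ n := by exact_mod_cast hn
  have hnp : (0 : ℝ) < n := by linarith
  have hps : ∀ a, 0 < π a * s a ^ 2 := fun a => mul_pos (hπ0 a) (pow_pos (hs a) 2)
  set c : ℝ := 1 / (n : ℝ) with hc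
  have hc0 : 0 < c := by positivity
  have hc1 : c ≤ 1 := by rw [hc, div_le_one hnp]; exact hn0
  set M := Finset.univ.sup' ⟨⟨0, hK⟩, Finset.mem_univ _⟩ (fun a => h a ^ 2 / s a ^ 2) with hM
  set m := Finset.univ.sup' ⟨⟨0, hK⟩, Finset.mem_univ _⟩
    (fun a => h a ^ 2 / (s a ^ 2 + h a ^ 2)) with hm
  have hMa : ∀ a, h a ^ 2 / s a ^ 2 ≤ M := fun a =>
    Finset.le_sup' (fun a => h a ^ 2 / s a ^ 2) (Finset.mem_univ a)
  have hma : ∀ a, h a ^ 2 / (s a ^ 2 + h a ^ 2) ≤ m := fun a =>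
    Finset.le_sup' (fun a => h a ^ 2 / (s a ^ 2 + h a ^ 2)) (Finset.mem_univ a)
  have hM0 : 0 ≤ M := le_trans (by positivity) (hMa ⟨0, hK⟩)
  have hm0 : 0 ≤ m := le_trans (by positivity) (hma ⟨0, hK⟩)
  have hm1 : m < 1 := by
    refine (Finset.sup'_lt_iff _).2 ?_
    intro a _
    have := pow_pos (hs a) 2
    rw [div_lt_one (by positivity)]
    linarith
  -- trace
  have htr : ((Matrix.diagonal (fun a => π a * s a ^ 2))⁻¹ *
          (Matrix.diagonal (fun a => π a * s a ^ 2) +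
            c • Matrix.diagonal (fun a => π a * h a ^ 2) -
            c • Matrix.vecMulVec (fun a => π a * h a)
              (fun a => π a * h a))).trace ≤ K + c * ∑ a, h a ^ 2 / s a ^ 2 := by
    have hinv : (Matrix.diagonal (fun a => π a * s a ^ 2))⁻¹
        = Matrix.diagonal (fun a => (π a * s a ^ 2)⁻¹) := by
      apply Matrix.inv_eq_right_inv
      rw [Matrix.diagonal_mul_diagonal, ← Matrix.diagonal_one]
      congr 1
      funext a
      exact mul_inv_cancel₀ (hps a).ne'
    rw [hinv, Matrix.trace]
    have hK' : (K : ℝ) = ∑ _a : Fin K, (1 : ℝ) := by simp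
    rw [hK', Finset.mul_sum, ← Finset.sum_add_distrib]
    apply Finset.sum_le_sum
    intro a _
    rw [Matrix.diag_apply, Matrix.diagonal_mul]
    simp only [Matrix.sub_apply, Matrix.add_apply, Matrix.smul_apply, Matrix.vecMulVec_apply,
      Matrix.diagonal_apply_eq, smul_eq_mul]
    have h1 := (hs a).ne'
    have h2 := (hπ0 a).ne'
    have e : (π a * s a ^ 2)⁻¹ * (π a * s a ^ 2 + c * (π a * h a ^ 2) - c * (π a * h a * (π a * h a)))
        = 1 + c * (h a ^ 2 / s a ^ 2) - c * π a * (h a ^ 2 / s a ^ 2) := by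
      field_simp
    rw [e]
    have : 0 ≤ c * π a * (h a ^ 2 / s a ^ 2) :=
      mul_nonneg (mul_nonneg hc0.le (hπ0 a).le) (by positivity)
    linarith
  -- determinant
  set d : Fin K → ℝ := fun a => π a * s a ^ 2 + c * (π a * h a ^ 2) with hd
  have hsd : ∀ a, π a * s a ^ 2 ≤ d a := fun a => by
    have : 0 ≤ c * (π a * h a ^ 2) :=
      mul_nonneg hc0.le (mul_nonneg (hπ0 a).le (sq_nonneg _))
    simp only [hd]; linarith
  have hdp : ∀ a, 0 < d a := fun a => lt_of_lt_of_le (hps a) (hsd a)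
  have hdet : (Matrix.diagonal (fun a => π a * s a ^ 2) +
          c • Matrix.diagonal (fun a => π a * h a ^ 2) -
          c • Matrix.vecMulVec (fun a => π a * h a)
            (fun a => π a * h a)).det
      = (∏ a, d a) * (1 - ∑ a, c * (π a * h a) ^ 2 / d a) := by
    rw [← aux_det K d (fun a => π a * h a) c (fun a => (hdp a).ne'), ← Matrix.diagonal_smul,
      Matrix.diagonal_add]
    rfl
  set q := ∑ a, c * (π a * h a) ^ 2 / d a with hq
  have hterm : ∀ a, c * (π a * h a) ^ 2 / d a
      = π a * (c * h a ^ 2 / (s a ^ 2 + c * h a ^ 2)) := fun a => by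
    have h1 := pow_pos (hs a) 2
    have h2 := (hπ0 a)
    have h3 : 0 < s a ^ 2 + c * h a ^ 2 := by positivity
    have h4 : d a = π a * (s a ^ 2 + c * h a ^ 2) := by simp only [hd]; ring
    rw [h4]
    field_simp
  have havg : ∀ B : ℝ, 0 ≤ B → (∀ a, c * h a ^ 2 / (s a ^ 2 + c * h a ^ 2) ≤ B) → q ≤ B := by
    intro B hB hle
    calc q ≤ ∑ a, π a * B := by
          apply Finset.sum_le_sum
          intro a _
          rw [hterm a]
          exact mul_le_mul_of_nonneg_left (hle a) (hπ0 a).le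
      _ = (∑ a, π a) * B := by rw [Finset.sum_mul]
      _ ≤ 1 * B := mul_le_mul_of_nonneg_right hsum hB
      _ = B := one_mul B
  have hqm : q ≤ m := by
    apply havg m hm0
    intro a
    refine le_trans ?_ (hma a)
    have h1 := pow_pos (hs a) 2
    rw [div_le_div_iff₀ (by positivity) (by positivity)]
    have : 0 ≤ (1 - c) * (h a ^ 2 * s a ^ 2) :=
      mul_nonneg (by linarith) (by positivity)
    nlinarith
  have hqM : q ≤ c * M := by
    apply havg (c * M) (by positivity)
    intro a
    have h1 := pow_pos (hs a) 2
    calc c * h a ^ 2 / (s a ^ 2 + c * h a ^ 2) ≤ c * h a ^ 2 / s a ^ 2 := by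
          apply div_le_div_of_nonneg_left (by positivity) h1
          have : 0 ≤ c * h a ^ 2 := by positivity
          linarith
      _ = c * (h a ^ 2 / s a ^ 2) := by ring
      _ ≤ c * M := mul_le_mul_of_nonneg_left (hMa a) hc0.le
  have hq1 : 0 < 1 - q := by linarith
  have hlog : -Real.log (1 - q) ≤ c * (M / (1 - m)) := by
    have h1 := Real.one_sub_inv_le_log_of_pos hq1
    have h2 : (1 - q)⁻¹ - 1 = q / (1 - q) := by field_simp; ring
    have h3 : q / (1 - q) ≤ c * M / (1 - m) :=
      div_le_div₀ (by positivity) hqM (by linarith) (by linarith)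
    have h4 : c * (M / (1 - m)) = c * M / (1 - m) := by ring
    linarith
  have hprod : Real.log (∏ a, π a * s a ^ 2) ≤ Real.log (∏ a, d a) := by
    apply Real.log_le_log (Finset.prod_pos fun a _ => hps a)
    exact Finset.prod_le_prod (fun a _ => (hps a).le) (fun a _ => hsd a)
  rw [hdet, Matrix.det_diagonal,
    Real.log_mul (Finset.prod_pos fun a _ => hdp a).ne' hq1.ne', mul_add]
  linarith
end

section
/- Let K ≥ 1 and for each a ∈ {1,…,K} let f_a : ℝ → ℝ be a differentiable, nonnegative, integrable function with ∫_ℝ f_a(u) du = 1 and with f_a' integrable. Define f : ℝ^K → ℝ by f(x) = ∏_{a=1}^K f_a(x_a). Then f is differentiable and ∫_{ℝ^K} ‖∇f(x)‖₂ dx ≤ Σ_{a=1}^K ∫_ℝ |f_a'(u)| du, where ∇f(x) is the gradient of f at x and ‖·‖₂ is the Euclidean norm on ℝ^K. -/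
open MeasureTheory

/-- For a product density `f x = ∏ a, f a (x a)` of differentiable one-dimensional
probability densities with integrable derivatives, `f` is differentiable and
`∫ ‖∇ f x‖ dx ≤ ∑ a, ∫ |(f a)' u| du`. -/
theorem integral_norm_gradient_prod_le
    (K : ℕ) (hK : 1 ≤ K) (f : Fin K → ℝ → ℝ)
    (hdiff : ∀ a, Differentiable ℝ (f a))
    (hnonneg : ∀ a, ∀ u, 0 ≤ f a u)
    (hint : ∀ a, Integrable (f a))
    (hone : ∀ a, ∫ u, f a u = 1)
    (hderiv : ∀ a, Integrable (deriv (f a))) :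
    Differentiable ℝ (fun x : EuclideanSpace ℝ (Fin K) => ∏ a, f a (x a)) ∧
      ∫ x : EuclideanSpace ℝ (Fin K),
          ‖gradient (fun y : EuclideanSpace ℝ (Fin K) => ∏ a, f a (y a)) x‖ ≤
        ∑ a, ∫ u, |deriv (f a) u| := by
  have hproj : ∀ (a : Fin K), ‖(EuclideanSpace.proj a : EuclideanSpace ℝ (Fin K) →L[ℝ] ℝ)‖ ≤ 1 := by
    intro a
    refine ContinuousLinearMap.opNorm_le_bound _ zero_le_one ?_
    intro x
    simpa using PiLp.norm_apply_le x a
  have hF : ∀ x : EuclideanSpace ℝ (Fin K),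
      HasFDerivAt (fun x : EuclideanSpace ℝ (Fin K) => ∏ a, f a (x a))
        (∑ a, (∏ b ∈ Finset.univ.erase a, f b (x b)) •
          (deriv (f a) (x a) • (EuclideanSpace.proj a : EuclideanSpace ℝ (Fin K) →L[ℝ] ℝ))) x := by
    intro x
    refine HasFDerivAt.finsetProd (g := fun a (x : EuclideanSpace ℝ (Fin K)) => f a (x a)) ?_
    intro a _
    exact HasDerivAt.comp_hasFDerivAt (h₂ := f a) x ((hdiff a) (x a)).hasDerivAt
      (EuclideanSpace.proj a : EuclideanSpace ℝ (Fin K) →L[ℝ] ℝ).hasFDerivAt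
  refine ⟨fun x => (hF x).differentiableAt, ?_⟩
  let g : Fin K → Fin K → ℝ → ℝ := fun a b u => if b = a then |deriv (f a) u| else f b u
  have hg : ∀ a b, Integrable (g a b) := by
    intro a b
    by_cases h : b = a
    · simpa [g, h] using (hderiv a).abs
    · simpa [g, h] using hint b
  have hgi : ∀ a, Integrable (fun x : Fin K → ℝ => ∏ b, g a b (x b)) :=
    fun a => Integrable.fintype_prod (hg a)
  have hgE : ∀ a, Integrable (fun x : EuclideanSpace ℝ (Fin K) => ∏ b, g a b (x b)) :=
    fun a => (PiLp.volume_preserving_ofLp (Fin K)).integrable_comp_of_integrable (hgi a)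
  have hgv : ∀ a, ∫ x : EuclideanSpace ℝ (Fin K), ∏ b, g a b (x b) = ∫ u, |deriv (f a) u| := by
    intro a
    have h1 := (PiLp.volume_preserving_ofLp (Fin K)).integral_comp
      (MeasurableEquiv.toLp 2 (Fin K → ℝ)).symm.measurableEmbedding
      (fun x : Fin K → ℝ => ∏ b, g a b (x b))
    refine h1.trans ?_
    rw [integral_fintype_prod_volume_eq_prod, Finset.prod_eq_single a]
    · simp [g]
    · intro b _ hb
      simp [g, hb, hone b]
    · simp
  have hb : ∀ x : EuclideanSpace ℝ (Fin K),
      ‖gradient (fun y : EuclideanSpace ℝ (Fin K) => ∏ a, f a (y a)) x‖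
        ≤ ∑ a, ∏ b, g a b (x b) := by
    intro x
    rw [gradient, LinearIsometryEquiv.norm_map, (hF x).fderiv]
    refine (norm_sum_le _ _).trans (Finset.sum_le_sum fun a _ => ?_)
    have hp : 0 ≤ ∏ b ∈ Finset.univ.erase a, f b (x b) :=
      Finset.prod_nonneg fun b _ => hnonneg b _
    have he : ∏ b, g a b (x b)
        = |deriv (f a) (x a)| * ∏ b ∈ Finset.univ.erase a, f b (x b) := by
      rw [← Finset.mul_prod_erase _ _ (Finset.mem_univ a)]
      congr 1
      · simp [g]
      · refine Finset.prod_congr rfl fun b hb => ?_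
        simp [g, Finset.ne_of_mem_erase hb]
    rw [he, norm_smul, norm_smul, Real.norm_of_nonneg hp, Real.norm_eq_abs, mul_comm]
    refine mul_le_mul_of_nonneg_right ?_ hp
    exact mul_le_of_le_one_right (abs_nonneg _) (hproj a)
  calc _ ≤ ∫ x : EuclideanSpace ℝ (Fin K), ∑ a, ∏ b, g a b (x b) :=
        integral_mono_of_nonneg (Filter.Eventually.of_forall fun x => norm_nonneg _)
          (integrable_finsetSum _ fun a _ => hgE a) (Filter.Eventually.of_forall hb)
    _ = ∑ a, ∫ u, |deriv (f a) u| := by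
        rw [integral_finsetSum _ fun a _ => hgE a]
        exact Finset.sum_congr rfl fun a _ => hgv a
end
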